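/- (Corollary 1, effects of β) Under the hypotheses of Theorem 2 — λ a σ-finite measure on Ω, μ = λ.withDensity p and ν = λ.withDensity q probability measures, S ⊆ Ω measurable, b ∈ (0,1], κ ≥ 1, 1/κ ≤ β ≤ 1, Z = 1 − b/κ + β·b, μ(S) = b/κ, ν(S) = β·b/Z, q = p/Z λ-a.e. off S, and S_val = ∫_S max(q/ν(S) − p/μ(S), 0) dλ — one has S_val · b / κ ≤ d_{H−W1}(μ, ν) ≤ κ·b / (κ + κ·b − b). -/

import Mathlib

open MeasureTheory

/-- The `H`–`W1` distance between two measures: the supremum of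
`∫ h dμ − ∫ h dν` over measurable functions `h` with values in `[0,1]`. -/
noncomputable def dHW1 {Ω : Type*} [MeasurableSpace Ω] (μ ν : Measure Ω) : ℝ :=
  sSup {r : ℝ | ∃ h : Ω → ℝ, Measurable h ∧ (∀ ω, 0 ≤ h ω) ∧ (∀ ω, h ω ≤ 1) ∧
    r = ∫ ω, h ω ∂μ - ∫ ω, h ω ∂ν}

theorem integral_withDensity_ofReal {Ω : Type*} [MeasurableSpace Ω] {lam : Measure Ω}
    {p : Ω → ℝ} (hp : Measurable p) (hp0 : ∀ ω, 0 ≤ p ω) (f : Ω → ℝ) :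
    ∫ ω, f ω ∂(lam.withDensity fun ω => ENNReal.ofReal (p ω)) = ∫ ω, p ω * f ω ∂lam := by
  rw [integral_withDensity_eq_integral_toReal_smul hp.ennreal_ofReal
    (Filter.Eventually.of_forall fun _ => ENNReal.ofReal_lt_top)]
  simp only [ENNReal.toReal_ofReal (hp0 _), smul_eq_mul]

theorem integrable_of_isFiniteMeasure_withDensity_ofReal {Ω : Type*} [MeasurableSpace Ω]
    {lam : Measure Ω} {p : Ω → ℝ} (hp : Measurable p) (hp0 : ∀ ω, 0 ≤ p ω)
    [IsFiniteMeasure (lam.withDensity fun ω => ENNReal.ofReal (p ω))] : Integrable p lam := by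
  have h := (integrable_withDensity_iff hp.ennreal_ofReal
    (Filter.Eventually.of_forall fun _ => ENNReal.ofReal_lt_top)).1
      (integrable_const (1 : ℝ) (μ := lam.withDensity fun ω => ENNReal.ofReal (p ω)))
  simpa only [ENNReal.toReal_ofReal (hp0 _), one_mul] using h

theorem toReal_withDensity_ofReal {Ω : Type*} [MeasurableSpace Ω] {lam : Measure Ω}
    {p : Ω → ℝ} (hp : Measurable p) (hp0 : ∀ ω, 0 ≤ p ω) {S : Set Ω} (hS : MeasurableSet S) :
    ((lam.withDensity fun ω => ENNReal.ofReal (p ω)) S).toReal = ∫ ω in S, p ω ∂lam := by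
  rw [withDensity_apply _ hS, integral_eq_lintegral_of_nonneg_ae
    (Filter.Eventually.of_forall hp0) hp.aestronglyMeasurable]

theorem integrable_of_mem_unitInterval {Ω : Type*} [MeasurableSpace Ω] {μ : Measure Ω}
    [IsFiniteMeasure μ] {h : Ω → ℝ} (hm : Measurable h) (h0 : ∀ ω, 0 ≤ h ω)
    (h1 : ∀ ω, h ω ≤ 1) : Integrable h μ :=
  Integrable.of_bound hm.aestronglyMeasurable 1
    (Filter.Eventually.of_forall fun ω => by rw [Real.norm_of_nonneg (h0 ω)]; exact h1 ω)

theorem integral_sub_integral_le_dHW1 {Ω : Type*} [MeasurableSpace Ω] (μ ν : Measure Ω)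
    [IsProbabilityMeasure μ] [IsProbabilityMeasure ν] {h : Ω → ℝ} (hm : Measurable h)
    (h0 : ∀ ω, 0 ≤ h ω) (h1 : ∀ ω, h ω ≤ 1) :
    ∫ ω, h ω ∂μ - ∫ ω, h ω ∂ν ≤ dHW1 μ ν := by
  refine le_csSup ⟨1, ?_⟩ ⟨h, hm, h0, h1, rfl⟩
  rintro r ⟨g, gm, g0, g1, rfl⟩
  have hμ : ∫ ω, g ω ∂μ ≤ ∫ _, (1 : ℝ) ∂μ :=
    integral_mono (integrable_of_mem_unitInterval gm g0 g1) (integrable_const _) g1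
  have hν : 0 ≤ ∫ ω, g ω ∂ν := integral_nonneg g0
  simp only [integral_const, probReal_univ, smul_eq_mul, mul_one] at hμ
  linarith

theorem integral_sub_integral_one_sub {Ω : Type*} [MeasurableSpace Ω] (μ ν : Measure Ω)
    [IsProbabilityMeasure μ] [IsProbabilityMeasure ν] {h : Ω → ℝ} (hm : Measurable h)
    (h0 : ∀ ω, 0 ≤ h ω) (h1 : ∀ ω, h ω ≤ 1) :
    ∫ ω, (1 - h ω) ∂μ - ∫ ω, (1 - h ω) ∂ν = ∫ ω, h ω ∂ν - ∫ ω, h ω ∂μ := by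
  rw [integral_sub (integrable_const _) (integrable_of_mem_unitInterval hm h0 h1),
    integral_sub (integrable_const _) (integrable_of_mem_unitInterval hm h0 h1)]
  simp

/-- (Corollary 1, effects of β.) Under the hypotheses of Theorem 2, one has
`S_val·b/κ ≤ d_{H−W1}(μ, ν) ≤ κ·b/(κ + κ·b − b)`. -/
theorem dHW1_beta_effect {Ω : Type*} [MeasurableSpace Ω]
    (lam : Measure Ω) [SigmaFinite lam]
    (p q : Ω → ℝ) (hp : Measurable p) (hq : Measurable q)
    (hp0 : ∀ ω, 0 ≤ p ω) (hq0 : ∀ ω, 0 ≤ q ω)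
    (μ ν : Measure Ω) [IsProbabilityMeasure μ] [IsProbabilityMeasure ν]
    (hμ : μ = lam.withDensity fun ω => ENNReal.ofReal (p ω))
    (hν : ν = lam.withDensity fun ω => ENNReal.ofReal (q ω))
    (S : Set Ω) (hS : MeasurableSet S)
    (b κ β Z : ℝ) (hb0 : 0 < b) (hb1 : b ≤ 1) (hκ : 1 ≤ κ)
    (hβl : 1 / κ ≤ β) (hβu : β ≤ 1)
    (hZ : Z = 1 - b / κ + β * b)
    (hμS : (μ S).toReal = b / κ) (hνS : (ν S).toReal = β * b / Z)
    (hoff : ∀ᵐ ω ∂lam, ω ∉ S → q ω = p ω / Z)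
    (Sval : ℝ)
    (hSval : Sval = ∫ ω in S, max (q ω / (ν S).toReal - p ω / (μ S).toReal) 0 ∂lam) :
    Sval * b / κ ≤ dHW1 μ ν ∧ dHW1 μ ν ≤ κ * b / (κ + κ * b - b) := by
  have hκ0 : 0 < κ := by linarith
  have ha0 : 0 < b / κ := by positivity
  have ha1 : b / κ ≤ 1 := by rw [div_le_one hκ0]; linarith
  have haβ : b / κ ≤ β * b := by
    calc b / κ = 1 / κ * b := by ring
      _ ≤ β * b := by gcongr
  have hZ1 : 1 ≤ Z := by linarith
  have hZ0 : 0 < Z := by linarith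
  have has : b / κ ≤ β * b / Z := by
    rw [le_div_iff₀ hZ0, hZ]
    nlinarith [mul_nonneg (sub_nonneg.2 ha1) (sub_nonneg.2 haβ)]
  have hs0 : 0 < β * b / Z := ha0.trans_le has
  have hsu : β * b / Z ≤ κ * b / (κ + κ * b - b) := by
    have hden : 0 < κ + κ * b - b := by nlinarith
    have hκZ : κ * Z = κ - b + κ * (β * b) := by rw [hZ]; field_simp
    rw [div_le_div_iff₀ hZ0 hden]
    have hκb : κ * b * Z = b * (κ - b + κ * (β * b)) := by rw [← hκZ]; ring
    rw [hκb]
    nlinarith [mul_nonneg (mul_nonneg hb0.le (sub_nonneg.2 hβu)) (by linarith : 0 ≤ κ - b)]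
  have hpi : Integrable p lam := by
    have : IsFiniteMeasure (lam.withDensity fun ω => ENNReal.ofReal (p ω)) :=
      hμ ▸ inferInstance
    exact integrable_of_isFiniteMeasure_withDensity_ofReal hp hp0
  have hqi : Integrable q lam := by
    have : IsFiniteMeasure (lam.withDensity fun ω => ENNReal.ofReal (q ω)) :=
      hν ▸ inferInstance
    exact integrable_of_isFiniteMeasure_withDensity_ofReal hq hq0
  have hdiff : ∀ k : Ω → ℝ, Measurable k → (∀ ω, 0 ≤ k ω) → (∀ ω, k ω ≤ 1) →
      Integrable (fun ω => (q ω - p ω) * k ω) lam ∧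
        ∫ ω, k ω ∂ν - ∫ ω, k ω ∂μ = ∫ ω, (q ω - p ω) * k ω ∂lam := by
    intro k hk k0 k1
    have hbd : ∀ᵐ ω ∂lam, ‖k ω‖ ≤ 1 := Filter.Eventually.of_forall fun ω => by
      rw [Real.norm_of_nonneg (k0 ω)]; exact k1 ω
    refine ⟨(hqi.sub hpi).mul_bdd hk.aestronglyMeasurable hbd, ?_⟩
    rw [hμ, hν, integral_withDensity_ofReal hp hp0, integral_withDensity_ofReal hq hq0,
      ← integral_sub (hqi.mul_bdd hk.aestronglyMeasurable hbd)
        (hpi.mul_bdd hk.aestronglyMeasurable hbd)]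
    simp only [sub_mul]
  constructor
  · set T : Set Ω := S ∩ {ω | p ω / (b / κ) ≤ q ω / (β * b / Z)}
    have hTm : MeasurableSet T :=
      hS.inter (measurableSet_le (hp.div_const _) (hq.div_const _))
    have hk : Measurable (T.indicator fun _ => (1 : ℝ)) := measurable_const.indicator hTm
    have k0 : ∀ ω, 0 ≤ T.indicator (fun _ => (1 : ℝ)) ω := fun ω =>
      Set.indicator_nonneg (fun _ _ => zero_le_one) ω
    have k1 : ∀ ω, T.indicator (fun _ => (1 : ℝ)) ω ≤ 1 := fun ω =>
      Set.indicator_le_self' (fun _ _ => zero_le_one) ω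
    refine le_trans ?_ (integral_sub_integral_le_dHW1 μ ν
      (h := fun ω => 1 - T.indicator (fun _ => (1 : ℝ)) ω) (measurable_const.sub hk)
      (fun ω => sub_nonneg.2 (k1 ω)) (fun ω => sub_le_self _ (k0 ω)))
    obtain ⟨hint, heq⟩ := hdiff _ hk k0 k1
    rw [integral_sub_integral_one_sub μ ν hk k0 k1, heq, mul_div_assoc, hSval, hμS, hνS,
      ← integral_indicator hS, ← integral_mul_const]
    refine integral_mono ?_ hint fun ω => ?_
    · exact ((((hqi.div_const _).sub (hpi.div_const _)).pos_part).indicator hS).mul_const _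
    · by_cases hωS : ω ∈ S
      · simp only [Set.indicator_of_mem hωS]
        by_cases hle : p ω / (b / κ) ≤ q ω / (β * b / Z)
        · rw [Set.indicator_of_mem (show ω ∈ T from ⟨hωS, hle⟩), max_eq_left (sub_nonneg.2 hle),
            mul_one, sub_mul, div_mul_cancel₀ _ ha0.ne']
          have : q ω / (β * b / Z) * (b / κ) ≤ q ω := by
            rw [div_mul_eq_mul_div, div_le_iff₀ hs0]
            exact mul_le_mul_of_nonneg_left has (hq0 ω)
          linarith
        · rw [Set.indicator_of_notMem (fun h : ω ∈ T => hle h.2),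
            max_eq_right (sub_nonpos.2 (not_le.1 hle).le)]
          simp
      · rw [Set.indicator_of_notMem (fun h : ω ∈ T => hωS h.1)]
        simp [hωS]
  · refine le_trans (csSup_le ⟨_, 0, measurable_const, fun _ => le_rfl, fun _ => zero_le_one, rfl⟩
      ?_) hsu
    rintro r ⟨h, hm, h0, h1, rfl⟩
    have hk : Measurable fun ω => 1 - h ω := measurable_const.sub hm
    have k0 : ∀ ω, 0 ≤ 1 - h ω := fun ω => sub_nonneg.2 (h1 ω)
    have k1 : ∀ ω, 1 - h ω ≤ 1 := fun ω => sub_le_self _ (h0 ω)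
    obtain ⟨hint, heq⟩ := hdiff _ hk k0 k1
    have hflip := integral_sub_integral_one_sub ν μ hm h0 h1
    rw [← hflip, heq, ← hνS, hν, toReal_withDensity_ofReal hq hq0 hS, ← integral_indicator hS]
    refine integral_mono_ae hint (hqi.indicator hS) ?_
    filter_upwards [hoff] with ω hω
    by_cases hωS : ω ∈ S
    · rw [Set.indicator_of_mem hωS]
      nlinarith [mul_nonneg (hp0 ω) (k0 ω), mul_nonneg (hq0 ω) (h0 ω)]
    · rw [Set.indicator_of_notMem hωS, hω hωS]
      exact mul_nonpos_of_nonpos_of_nonneg (sub_nonpos.2 (div_le_self (hp0 ω) hZ1)) (k0 ω)
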